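/- Let 0 < α < 1, let 0 = t_0 < t_1 < ⋯ < t_N be a partition with step sizes τ_n = t_n − t_{n-1}, and let u : [0, t_N] → ℝ be the continuous piecewise-linear function with nodal values u(t_j) = u^j, i.e. u(t) = τ_n^{-1}(t − t_{n-1}) u^n + τ_n^{-1}(t_n − t) u^{n-1} for t ∈ [t_{n-1}, t_n]. Then for each 1 ≤ n ≤ N, (1/τ_n) ∫_{t_{n-1}}^{t_n} (∂_t^α u)(t) dt = ∑_{j=1}^n ω^α_{nj} (u^j − u^{j-1}), where ω^α_{nn} = ω_{3-α}(τ_n)/τ_n² and, for 1 ≤ j ≤ n−1, ω^α_{nj} = (1/(τ_n τ_j)) ∫_{t_{n-1}}^{t_n} ∫_{t_{j-1}}^{t_j} ω_{1-α}(t-s) ds dt. -/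

import Mathlib

open MeasureTheory Real Set

/-- `omega μ t = t^(μ-1)/Γ(μ)`. -/
noncomputable def omega (μ : ℝ) (t : ℝ) : ℝ := t ^ (μ - 1) / Real.Gamma μ

theorem continuous_omega {μ : ℝ} (hμ : 1 ≤ μ) : Continuous (omega μ) := by
  unfold omega
  exact (Real.continuous_rpow_const (by linarith)).div_const _

theorem intervalIntegrable_omega {μ : ℝ} (hμ : 0 < μ) (a b : ℝ) :
    IntervalIntegrable (omega μ) volume a b := by
  unfold omega
  exact (intervalIntegral.intervalIntegrable_rpow' (by linarith)).div_const _

theorem intervalIntegrable_omega_sub_left {μ : ℝ} (hμ : 0 < μ) (r a b : ℝ) :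
    IntervalIntegrable (fun s => omega μ (r - s)) volume a b := by
  simpa using (intervalIntegrable_omega hμ (r - a) (r - b)).comp_sub_left r

theorem integral_omega {μ : ℝ} (hμ : 0 < μ) (a b : ℝ) :
    ∫ x in a..b, omega μ x = omega (μ + 1) b - omega (μ + 1) a := by
  have hΓ : Real.Gamma μ ≠ 0 := (Real.Gamma_pos_of_pos hμ).ne'
  unfold omega
  rw [intervalIntegral.integral_div, integral_rpow (Or.inl (by linarith)),
    Real.Gamma_add_one hμ.ne', show μ - 1 + 1 = μ by ring, show μ + 1 - 1 = μ by ring]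
  field_simp

theorem omega_zero {μ : ℝ} (hμ : μ ≠ 1) : omega μ 0 = 0 := by
  unfold omega
  rw [Real.zero_rpow (sub_ne_zero.mpr hμ), zero_div]

theorem integral_omega_sub_left {μ : ℝ} (hμ : 0 < μ) (r a b : ℝ) :
    ∫ s in a..b, omega μ (r - s) = omega (μ + 1) (r - a) - omega (μ + 1) (r - b) := by
  rw [intervalIntegral.integral_comp_sub_left (fun x => omega μ x), integral_omega hμ]

theorem continuous_integral_omega_sub_left {μ : ℝ} (hμ : 0 < μ) (a b : ℝ) :
    Continuous fun r => ∫ s in a..b, omega μ (r - s) := by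
  have h := continuous_omega (μ := μ + 1) (by linarith)
  simp_rw [integral_omega_sub_left hμ]
  fun_prop

/-- The average over an interval starting at `a` of the fractional integral started at `a`. -/
theorem integral_integral_omega_sub_left {μ : ℝ} (hμ : 0 < μ) (a b : ℝ) :
    ∫ r in a..b, ∫ s in a..r, omega μ (r - s) = omega (μ + 2) (b - a) := by
  simp_rw [integral_omega_sub_left hμ, sub_self, omega_zero (show μ + 1 ≠ 1 by linarith), sub_zero]
  rw [intervalIntegral.integral_comp_sub_right (fun x => omega (μ + 1) x),
    integral_omega (by linarith), sub_self, omega_zero (by linarith), sub_zero]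
  congr 1
  ring

theorem intervalIntegrable_mul_of_eq_const {g d : ℝ → ℝ} {a b c : ℝ} (hab : a ≤ b)
    (hg : IntervalIntegrable g volume a b) (hd : ∀ s ∈ Set.Ioc a b, d s = c) :
    IntervalIntegrable (fun s => g s * d s) volume a b := by
  refine (hg.mul_const c).congr fun s hs => ?_
  rw [Set.uIoc_of_le hab] at hs
  simp only [hd s hs]

theorem integral_mul_of_eq_const {g d : ℝ → ℝ} {a b c : ℝ} (hab : a ≤ b)
    (hd : ∀ s ∈ Set.Ioc a b, d s = c) :
    ∫ s in a..b, g s * d s = c * ∫ s in a..b, g s := by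
  rw [mul_comm, ← intervalIntegral.integral_mul_const]
  refine intervalIntegral.integral_congr_ae (.of_forall fun s hs => ?_)
  rw [Set.uIoc_of_le hab] at hs
  simp only [hd s hs]

/-- Integral of a function against a step function on a partition. -/
theorem intervalIntegrable_and_integral_mul_step {g d : ℝ → ℝ} {t c : ℕ → ℝ} {m : ℕ}
    (ht : ∀ j, j < m → t j ≤ t (j + 1)) (hg : ∀ a b, IntervalIntegrable g volume a b)
    (hd : ∀ j, 1 ≤ j → j ≤ m → ∀ s ∈ Set.Ioc (t (j - 1)) (t j), d s = c j) :
    IntervalIntegrable (fun s => g s * d s) volume (t 0) (t m) ∧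
      ∫ s in (t 0)..(t m), g s * d s =
        ∑ j ∈ Finset.Icc 1 m, c j * ∫ s in (t (j - 1))..(t j), g s := by
  induction m with
  | zero => simp
  | succ m ih =>
    obtain ⟨hi, he⟩ := ih (fun j hj => ht j (by omega)) fun j h1 h2 => hd j h1 (by omega)
    have hm := ht m (by omega)
    have hdm := hd (m + 1) (by omega) le_rfl
    rw [Nat.add_sub_cancel] at hdm
    have hi' := intervalIntegrable_mul_of_eq_const hm (hg _ _) hdm
    refine ⟨hi.trans hi', ?_⟩
    rw [← intervalIntegral.integral_add_adjacent_intervals hi hi', he,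
      integral_mul_of_eq_const hm hdm, Finset.sum_Icc_succ_top (by omega), Nat.add_sub_cancel]

theorem stmt_9 {α : ℝ} (hα0 : 0 < α) (hα1 : α < 1)
    (N : ℕ) (hN : 1 ≤ N) (t : ℕ → ℝ) (ht0 : t 0 = 0)
    (hmono : ∀ j, j < N → t j < t (j + 1))
    (U : ℕ → ℝ) (u du : ℝ → ℝ)
    (hu : ∀ j, 1 ≤ j → j ≤ N → ∀ s ∈ Set.Icc (t (j - 1)) (t j),
      u s = ((s - t (j - 1)) * U j + (t j - s) * U (j - 1)) / (t j - t (j - 1)))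
    (hdu : ∀ j, 1 ≤ j → j ≤ N → ∀ s ∈ Set.Ioc (t (j - 1)) (t j),
      du s = (U j - U (j - 1)) / (t j - t (j - 1)))
    (n : ℕ) (hn1 : 1 ≤ n) (hnN : n ≤ N) :
    (1 / (t n - t (n - 1))) *
        (∫ r in (t (n - 1))..(t n), ∫ s in (0:ℝ)..r, omega (1 - α) (r - s) * du s) =
      ∑ j ∈ Finset.Icc 1 n,
        (if j = n then omega (3 - α) (t n - t (n - 1)) / (t n - t (n - 1)) ^ 2
          else (1 / ((t n - t (n - 1)) * (t j - t (j - 1)))) *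
            ∫ r in (t (n - 1))..(t n), ∫ s in (t (j - 1))..(t j), omega (1 - α) (r - s)) *
          (U j - U (j - 1)) := by
  obtain ⟨m, rfl⟩ : ∃ m, n = m + 1 := ⟨n - 1, by omega⟩
  have hμ : 0 < 1 - α := by linarith
  have hm := hmono m (by omega)
  have hdm := hdu (m + 1) (by omega) hnN
  rw [Nat.add_sub_cancel] at hdm ⊢
  set c : ℕ → ℝ := fun j => (U j - U (j - 1)) / (t j - t (j - 1)) with hc
  have inner : ∀ r ∈ Set.uIcc (t m) (t (m + 1)),
      ∫ s in (0:ℝ)..r, omega (1 - α) (r - s) * du s =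
        (∑ j ∈ Finset.Icc 1 m, c j * ∫ s in (t (j - 1))..(t j), omega (1 - α) (r - s)) +
          c (m + 1) * ∫ s in (t m)..r, omega (1 - α) (r - s) := by
    intro r hr
    rw [Set.uIcc_of_le hm.le] at hr
    have hg := intervalIntegrable_omega_sub_left hμ r
    obtain ⟨hi, he⟩ := intervalIntegrable_and_integral_mul_step (m := m) (c := c)
      (fun j hj => (hmono j (by omega)).le) hg fun j h1 h2 => hdu j h1 (by omega)
    have hdr : ∀ s ∈ Set.Ioc (t m) r, du s = c (m + 1) :=
      fun s hs => hdm s ⟨hs.1, hs.2.trans hr.2⟩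
    rw [ht0] at hi he
    rw [← intervalIntegral.integral_add_adjacent_intervals hi
      (intervalIntegrable_mul_of_eq_const hr.1 (hg _ _) hdr), he,
      integral_mul_of_eq_const hr.1 hdr]
  have hcont : ∀ j, Continuous fun r =>
      c j * ∫ s in (t (j - 1))..(t j), omega (1 - α) (r - s) :=
    fun j => (continuous_integral_omega_sub_left hμ _ _).const_mul _
  have hcont' : Continuous fun r => c (m + 1) * ∫ s in (t m)..r, omega (1 - α) (r - s) := by
    have h := continuous_omega (μ := 1 - α + 1) (by linarith)
    simp_rw [integral_omega_sub_left hμ]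
    fun_prop
  rw [intervalIntegral.integral_congr inner, intervalIntegral.integral_add
    ((continuous_finsetSum _ fun j _ => hcont j).intervalIntegrable _ _)
    (hcont'.intervalIntegrable _ _),
    intervalIntegral.integral_finsetSum fun j _ => (hcont j).intervalIntegrable _ _,
    intervalIntegral.integral_const_mul, integral_integral_omega_sub_left hμ,
    Finset.sum_Icc_succ_top (by omega), if_pos rfl, mul_add, Finset.mul_sum,
    show 1 - α + 2 = 3 - α by ring]
  have hτ : t (m + 1) - t m ≠ 0 := (sub_pos.mpr hm).ne'
  congr 1
  · refine Finset.sum_congr rfl fun j hj => ?_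
    have hj' := Finset.mem_Icc.mp hj
    rw [if_neg (by omega), intervalIntegral.integral_const_mul, hc]
    simp only [div_eq_mul_inv, mul_inv]
    ring
  · simp only [hc, Nat.add_sub_cancel]
    field_simp
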